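/- arXiv:2104.01919 — 5 statements merged into one kernel-verified Lean document; each statement's English description precedes it below -/
import Mathlib

section
/- Let T_min : H₁ → H₂ and T_min† : H₂ → H₁ be densely defined closed operators between separable Hilbert spaces that are adjoint to each other (T_min ⊆ (T_min†)* and T_min† ⊆ T_min*). Set T_max := (T_min†)*. If the inclusion dom(T_min) ↪ H₁ (with the graph norm on the domain) is compact, then: (i) ker(T_min) is finite dimensional; (ii) ran(T_min) is closed in H₂ and ran(T_min*) is closed in H₁; (iii) H₁ = ker(T_min) ⊕⊥ ran(T_min*) and H₂ = ker(T_min*) ⊕⊥ ran(T_min). -/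
open scoped InnerProductSpace ComplexConjugate
noncomputable section

variable {H₁ H₂ : Type*} [NormedAddCommGroup H₁] [InnerProductSpace ℂ H₁] [CompleteSpace H₁]
  [NormedAddCommGroup H₂] [InnerProductSpace ℂ H₂] [CompleteSpace H₂]

/-- The domain of a graph submodule `G ⊆ E × F`, i.e. the first-coordinate projection. -/
def domOf {E F : Type*} [AddCommGroup E] [AddCommGroup F] [Module ℂ E] [Module ℂ F]
    (G : Submodule ℂ (E × F)) : Submodule ℂ E := G.map (LinearMap.fst ℂ E F)

/-- The range of (the operator with) graph `G ⊆ E × F`. -/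
def ranOf {E F : Type*} [AddCommGroup E] [AddCommGroup F] [Module ℂ E] [Module ℂ F]
    (G : Submodule ℂ (E × F)) : Submodule ℂ F := G.map (LinearMap.snd ℂ E F)

/-- The kernel of (the operator with) graph `G ⊆ E × F`: those `x` with `(x, 0) ∈ G`. -/
def kerOf {E F : Type*} [AddCommGroup E] [AddCommGroup F] [Module ℂ E] [Module ℂ F]
    (G : Submodule ℂ (E × F)) : Submodule ℂ E := G.comap (LinearMap.inl ℂ E F)

/-- The graph of `T_min` viewed as a submodule of the graph of `T_max := (T_min†)*`
(the latter is identified with `dom T_max` equipped with the graph norm). -/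
def minSub (Tmin : H₁ →ₗ.[ℂ] H₂) (Tdag : H₂ →ₗ.[ℂ] H₁) : Submodule ℂ Tdag.adjoint.graph :=
  Submodule.comap Tdag.adjoint.graph.subtype Tmin.graph

/-- The Cauchy data space `ȟ := dom(T_max)/dom(T_min)` of the FAP `(T_min, T_min†)`,
realised as the quotient of the graph of `T_max = (T_min†)*` by the graph of `T_min`. -/
abbrev HCheck (Tmin : H₁ →ₗ.[ℂ] H₂) (Tdag : H₂ →ₗ.[ℂ] H₁) :=
  Tdag.adjoint.graph ⧸ minSub Tmin Tdag

/-- The graph of the realisation `T_B` determined by a (generalised) boundary condition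
`B ⊆ ȟ`, namely `{v ∈ dom T_max : γ v ∈ B}` together with the values of `T_max`. -/
def bGraph (Tmin : H₁ →ₗ.[ℂ] H₂) (Tdag : H₂ →ₗ.[ℂ] H₁)
    (B : Submodule ℂ (HCheck Tmin Tdag)) : Submodule ℂ (H₁ × H₂) :=
  Submodule.map Tdag.adjoint.graph.subtype (Submodule.comap (minSub Tmin Tdag).mkQ B)

/-- The realisation `T_B` of the FAP determined by the boundary condition `B`. -/
def TB (Tmin : H₁ →ₗ.[ℂ] H₂) (Tdag : H₂ →ₗ.[ℂ] H₁)
    (B : Submodule ℂ (HCheck Tmin Tdag)) : H₁ →ₗ.[ℂ] H₂ :=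
  (bGraph Tmin Tdag B).toLinearPMap

/-- The Hardy space `C := γ(ker T_max) ⊆ ȟ`. -/
def hardy (Tmin : H₁ →ₗ.[ℂ] H₂) (Tdag : H₂ →ₗ.[ℂ] H₁) : Submodule ℂ (HCheck Tmin Tdag) :=
  Submodule.map (minSub Tmin Tdag).mkQ
    (Submodule.comap Tdag.adjoint.graph.subtype (LinearMap.ker (LinearMap.snd ℂ H₁ H₂)))

section LinearRelation

variable {E F : Type*} [NormedAddCommGroup E] [InnerProductSpace ℂ E]
  [NormedAddCommGroup F] [InnerProductSpace ℂ F]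

theorem mem_kerOf_iff {G : Submodule ℂ (E × F)} {x : E} : x ∈ kerOf G ↔ (x, (0 : F)) ∈ G :=
  Iff.rfl

theorem mem_ranOf_iff {G : Submodule ℂ (E × F)} {y : F} : y ∈ ranOf G ↔ ∃ x, (x, y) ∈ G := by
  simp [ranOf]

theorem isClosed_kerOf {G : Submodule ℂ (E × F)} (hG : IsClosed (G : Set (E × F))) :
    IsClosed (kerOf G : Set E) :=
  hG.preimage (by fun_prop : Continuous fun x : E => (x, (0 : F)))

theorem finiteDimensional_kerOf {G : Submodule ℂ (E × F)} (hG : IsClosed (G : Set (E × F)))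
    (hcompact : IsCompactOperator fun p : G => (p : E × F).1) :
    FiniteDimensional ℂ (kerOf G) := by
  let ι : kerOf G →L[ℂ] G :=
    ((ContinuousLinearMap.inl ℂ E F).comp (kerOf G).subtypeL).codRestrict G fun x => x.2
  have hι : IsCompactOperator fun x : kerOf G => (x : E) := hcompact.comp_clm ι
  exact .of_isCompactOperator_id (𝕜 := ℂ) (hι.codRestrict (fun x => x.2) (isClosed_kerOf hG))

/-- A Poincaré-type inequality: a closed relation whose domain is compactly included is bounded
below on the orthogonal complement of its kernel. -/
theorem exists_norm_fst_le_mul_norm_snd {G : Submodule ℂ (E × F)}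
    (hG : IsClosed (G : Set (E × F)))
    (hcompact : IsCompactOperator fun p : G => (p : E × F).1) :
    ∃ c : ℝ, 0 < c ∧ ∀ p ∈ G, p.1 ∈ (kerOf G)ᗮ → ‖p.1‖ ≤ c * ‖p.2‖ := by
  by_contra! h
  have hunit : ∀ n : ℕ, ∃ q ∈ G, q.1 ∈ (kerOf G)ᗮ ∧ ‖q.1‖ = 1 ∧ ‖q.2‖ ≤ 1 / ((n : ℝ) + 1) := by
    intro n
    obtain ⟨p, hp, hpk, hlt⟩ := h (n + 1) (by positivity)
    have hpos : 0 < ‖p.1‖ := lt_of_le_of_lt (by positivity) hlt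
    refine ⟨((‖p.1‖⁻¹ : ℝ) : ℂ) • p, G.smul_mem _ hp, Submodule.smul_mem _ _ hpk, ?_, ?_⟩
    · simp [norm_smul, hpos.ne']
    · rw [Prod.smul_snd, norm_smul, Complex.norm_real, norm_inv, norm_norm, inv_mul_eq_div,
        div_le_div_iff₀ hpos (by positivity)]
      linarith
  choose q hqG hqk hq1 hq2 using hunit
  obtain ⟨K, hK, hKsub⟩ := IsCompactOperator.image_closedBall_subset_compact
    (f := (LinearMap.fst ℂ E F).comp G.subtype) hcompact 1
  have hqK : ∀ n, (q n).1 ∈ K := by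
    refine fun n => hKsub ⟨⟨q n, hqG n⟩, ?_, rfl⟩
    rw [mem_closedBall_zero_iff, Submodule.coe_norm, Prod.norm_def]
    refine max_le (hq1 n).le ((hq2 n).trans ?_)
    rw [div_le_one (by positivity)]
    linarith [n.cast_nonneg (α := ℝ)]
  obtain ⟨x, -, φ, hφ, hx⟩ := hK.tendsto_subseq hqK
  have hsnd : Filter.Tendsto (fun n => (q n).2) Filter.atTop (nhds 0) :=
    squeeze_zero_norm hq2 tendsto_one_div_add_atTop_nhds_zero_nat
  have hxG : (x, (0 : F)) ∈ G :=
    hG.mem_of_tendsto (hx.prodMk_nhds (hsnd.comp hφ.tendsto_atTop))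
      (.of_forall fun n => hqG (φ n))
  have hxk : x ∈ (kerOf G)ᗮ :=
    (Submodule.isClosed_orthogonal _).mem_of_tendsto hx (.of_forall fun n => hqk (φ n))
  have hx0 : x = 0 := inner_self_eq_zero.1 ((Submodule.mem_orthogonal _ _).1 hxk x hxG)
  have hx1 : ‖x‖ = 1 :=
    tendsto_nhds_unique hx.norm (by simp [hq1])
  simp [hx0] at hx1

theorem exists_mem_orthogonal_kerOf {G : Submodule ℂ (E × F)}
    [(kerOf G).HasOrthogonalProjection] {p : E × F} (hp : p ∈ G) :
    ∃ k ∈ kerOf G, ∃ x ∈ (kerOf G)ᗮ, p.1 = k + x ∧ (x, p.2) ∈ G := by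
  obtain ⟨k, hk, x, hx, hkx⟩ := (kerOf G).exists_add_mem_mem_orthogonal p.1
  refine ⟨k, hk, x, hx, hkx, ?_⟩
  have h := G.sub_mem hp (mem_kerOf_iff.1 hk)
  rwa [show p - (k, (0 : F)) = (x, p.2) by ext <;> simp [hkx]] at h

/-- The part of a linear relation lying over the orthogonal complement of its kernel. -/
def coreOf (G : Submodule ℂ (E × F)) : Submodule ℂ (E × F) :=
  G ⊓ (kerOf G)ᗮ.comap (LinearMap.fst ℂ E F)

theorem isClosed_coreOf {G : Submodule ℂ (E × F)} (hG : IsClosed (G : Set (E × F))) :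
    IsClosed (coreOf G : Set (E × F)) :=
  hG.inter ((Submodule.isClosed_orthogonal _).preimage continuous_fst)

/-- The second projection restricted to `coreOf G`. -/
def coreSnd (G : Submodule ℂ (E × F)) : coreOf G →L[ℂ] F :=
  (ContinuousLinearMap.snd ℂ E F).comp (coreOf G).subtypeL

theorem range_coreSnd (G : Submodule ℂ (E × F)) [(kerOf G).HasOrthogonalProjection] :
    (coreSnd G).range = ranOf G := by
  ext y
  rw [mem_ranOf_iff]
  constructor
  · rintro ⟨p, rfl⟩
    exact ⟨_, p.2.1⟩
  · rintro ⟨x, hxy⟩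
    obtain ⟨-, -, x', hx', -, hG'⟩ := exists_mem_orthogonal_kerOf hxy
    exact ⟨⟨(x', y), hG', hx'⟩, rfl⟩

theorem exists_antilipschitzWith_coreSnd {G : Submodule ℂ (E × F)}
    (hG : IsClosed (G : Set (E × F)))
    (hcompact : IsCompactOperator fun p : G => (p : E × F).1) :
    ∃ c, AntilipschitzWith c (coreSnd G) := by
  obtain ⟨c, hc, hle⟩ := exists_norm_fst_le_mul_norm_snd hG hcompact
  refine ⟨⟨max c 1, by positivity⟩, AddMonoidHomClass.antilipschitz_of_bound _ fun p => ?_⟩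
  change max ‖(p : E × F).1‖ ‖(p : E × F).2‖ ≤ max c 1 * ‖(p : E × F).2‖
  refine max_le ((hle p p.2.1 p.2.2).trans ?_) ?_
  · gcongr
    exact le_max_left _ _
  · exact le_mul_of_one_le_left (norm_nonneg _) (le_max_right _ _)

theorem kerOf_adjoint (G : Submodule ℂ (E × F)) : kerOf G.adjoint = (ranOf G)ᗮ := by
  ext y
  simp only [mem_kerOf_iff, Submodule.mem_adjoint_iff, Submodule.mem_orthogonal, mem_ranOf_iff,
    inner_zero_right, sub_zero]
  exact ⟨fun h b ⟨a, hab⟩ => h a b hab, fun h a b hab => h b ⟨a, hab⟩⟩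

theorem isClosed_ranOf [CompleteSpace E] [CompleteSpace F] {G : Submodule ℂ (E × F)}
    (hG : IsClosed (G : Set (E × F)))
    (hcompact : IsCompactOperator fun p : G => (p : E × F).1) :
    IsClosed (ranOf G : Set F) := by
  have := finiteDimensional_kerOf hG hcompact
  have := (isClosed_coreOf hG).completeSpace_coe
  obtain ⟨c, hc⟩ := exists_antilipschitzWith_coreSnd hG hcompact
  rw [← range_coreSnd]
  exact hc.isClosed_range (coreSnd G).uniformContinuous

theorem ranOf_adjoint [CompleteSpace F] {G : Submodule ℂ (E × F)}
    (hG : IsClosed (G : Set (E × F)))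
    (hcompact : IsCompactOperator fun p : G => (p : E × F).1) :
    ranOf G.adjoint = (kerOf G)ᗮ := by
  have := finiteDimensional_kerOf hG hcompact
  refine le_antisymm (fun z hz => ?_) fun z hz => ?_
  · obtain ⟨y, hyz⟩ := mem_ranOf_iff.1 hz
    refine (Submodule.mem_orthogonal _ _).2 fun x hx => ?_
    simpa using (Submodule.mem_adjoint_iff _ _).1 hyz x 0 hx
  · obtain ⟨c, hc⟩ := exists_antilipschitzWith_coreSnd hG hcompact
    let e := LinearEquiv.ofInjective (coreSnd G).toLinearMap hc.injective
    let ℓ : coreOf G →L[ℂ] ℂ :=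
      (innerSL ℂ z).comp ((ContinuousLinearMap.fst ℂ E F).comp (coreOf G).subtypeL)
    have hbound : ∀ y, ‖(ℓ.toLinearMap.comp e.symm.toLinearMap) y‖ ≤ ‖ℓ‖ * c * ‖y‖ := by
      intro y
      obtain ⟨p, rfl⟩ := e.surjective y
      have hp : ‖p‖ ≤ c * ‖coreSnd G p‖ := by
        simpa using hc.le_mul_dist p 0
      calc ‖(ℓ.toLinearMap.comp e.symm.toLinearMap) (e p)‖ = ‖ℓ p‖ := by simp
        _ ≤ ‖ℓ‖ * (c * ‖coreSnd G p‖) := (ℓ.le_opNorm p).trans (by gcongr)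
        _ = ‖ℓ‖ * c * ‖e p‖ := by rw [mul_assoc]; rfl
    obtain ⟨ψ, hψ, -⟩ := exists_extension_norm_eq _
      (LinearMap.mkContinuous (ℓ.toLinearMap.comp e.symm.toLinearMap) _ hbound)
    have hψ' : ∀ p : coreOf G, ψ (p : E × F).2 = ⟪z, (p : E × F).1⟫_ℂ := fun p =>
      (hψ (e p)).trans (by simp [ℓ])
    refine mem_ranOf_iff.2 ⟨(InnerProductSpace.toDual ℂ F).symm ψ,
      (Submodule.mem_adjoint_iff _ _).2 fun a b hab => ?_⟩
    obtain ⟨k, hk, x, hx, rfl, hxb⟩ := exists_mem_orthogonal_kerOf hab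
    rw [← inner_conj_symm, InnerProductSpace.toDual_symm_apply, hψ' ⟨(x, b), hxb, hx⟩,
      inner_conj_symm, inner_add_left, (Submodule.mem_orthogonal _ _).1 hz k hk]
    simp

end LinearRelation

/-- Let `(T_min, T_min†)` be a formally adjointed pair of densely defined
closed operators between separable Hilbert spaces.  If the inclusion of `dom T_min` (with
the graph norm, i.e. the graph of `T_min`) into `H₁` is compact, then `ker T_min` is finite
dimensional, `ran T_min` and `ran T_min*` are closed, and one has the orthogonal
decompositions `H₁ = ker(T_min) ⊕⊥ ran(T_min*)` and `H₂ = ker(T_min*) ⊕⊥ ran(T_min)`. -/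
theorem stmt_1 (Tmin : H₁ →ₗ.[ℂ] H₂) (Tdag : H₂ →ₗ.[ℂ] H₁)
    (hd₁ : Dense (Tmin.domain : Set H₁)) (hd₂ : Dense (Tdag.domain : Set H₂))
    (hc₁ : Tmin.IsClosed) (hc₂ : Tdag.IsClosed)
    (ha₁ : Tmin ≤ Tdag.adjoint) (ha₂ : Tdag ≤ Tmin.adjoint)
    (hcompact : IsCompactOperator fun p : Tmin.graph => (p : H₁ × H₂).1) :
    FiniteDimensional ℂ (kerOf Tmin.graph) ∧
    IsClosed ((ranOf Tmin.graph : Submodule ℂ H₂) : Set H₂) ∧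
    IsClosed ((ranOf Tmin.adjoint.graph : Submodule ℂ H₁) : Set H₁) ∧
    ranOf Tmin.adjoint.graph = (kerOf Tmin.graph)ᗮ ∧
    ranOf Tmin.graph = (kerOf Tmin.adjoint.graph)ᗮ := by
  have hclosed := isClosed_ranOf hc₁ hcompact
  rw [LinearPMap.adjoint_graph_eq_graph_adjoint hd₁, ranOf_adjoint hc₁ hcompact, kerOf_adjoint]
  refine ⟨finiteDimensional_kerOf hc₁ hcompact, hclosed, Submodule.isClosed_orthogonal _, rfl, ?_⟩
  rw [Submodule.orthogonal_orthogonal_eq_closure, hclosed.submodule_topologicalClosure_eq]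
end
end

section
/- Let (T_min, T_min†) be a FAP with T_max := (T_min†)* and T_max† := (T_min)*, and let B ⊆ ȟ := dom(T_max)/dom(T_min) be a (generalised) boundary condition with associated realisation T_B. Define the adjoint boundary condition B* := {w ∈ ȟ† : ω(w, v) = 0 for all v ∈ B}, where ȟ† := dom(T_max†)/dom(T_min†) and ω(w, v) = ⟨T_max† w̃, ṽ⟩ − ⟨w̃, T_max ṽ⟩ for any lifts w̃, ṽ. Then the Hilbert space adjoint of T_B equals the realisation T†_{B*} of T_min† determined by B*. -/
open scoped InnerProductSpace ComplexConjugate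
noncomputable section

variable {H₁ H₂ : Type*} [NormedAddCommGroup H₁] [InnerProductSpace ℂ H₁] [CompleteSpace H₁]
  [NormedAddCommGroup H₂] [InnerProductSpace ℂ H₂] [CompleteSpace H₂]

/-- The graph of the realisation `T†_{B*}` of `T_min†` determined by the adjoint boundary
condition `B* = {w ∈ ȟ† : ω(w, v) = 0 ∀ v ∈ B}`:  its elements are the pairs
`(w, T_max† w)` with `w ∈ dom T_max†` such that `⟪T_max† w, v⟫ = ⟪w, T_max v⟫` for all
`v ∈ dom T_B`. -/
def adjGraph (Tmin : H₁ →ₗ.[ℂ] H₂) (Tdag : H₂ →ₗ.[ℂ] H₁)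
    (B : Submodule ℂ (HCheck Tmin Tdag)) : Submodule ℂ (H₂ × H₁) where
  carrier := {q | q ∈ Tmin.adjoint.graph ∧
    ∀ p ∈ bGraph Tmin Tdag B, ⟪q.2, p.1⟫_ℂ = ⟪q.1, p.2⟫_ℂ}
  add_mem' := by
    rintro q q' ⟨hq, hq2⟩ ⟨hq', hq'2⟩
    refine ⟨Submodule.add_mem _ hq hq', fun p hp => ?_⟩
    simp only [Prod.fst_add, Prod.snd_add, inner_add_left]
    rw [hq2 p hp, hq'2 p hp]
  zero_mem' := ⟨Submodule.zero_mem _, fun p _ => by simp⟩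
  smul_mem' := by
    rintro c q ⟨hq, hq2⟩
    refine ⟨Submodule.smul_mem _ c hq, fun p hp => ?_⟩
    simp only [Prod.smul_fst, Prod.smul_snd, inner_smul_left]
    rw [hq2 p hp]

theorem bGraph_le_graph (Tmin : H₁ →ₗ.[ℂ] H₂) (Tdag : H₂ →ₗ.[ℂ] H₁)
    (B : Submodule ℂ (HCheck Tmin Tdag)) : bGraph Tmin Tdag B ≤ Tdag.adjoint.graph :=
  Submodule.map_subtype_le _ _

theorem graph_le_bGraph {Tmin : H₁ →ₗ.[ℂ] H₂} {Tdag : H₂ →ₗ.[ℂ] H₁} (h : Tmin ≤ Tdag.adjoint)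
    (B : Submodule ℂ (HCheck Tmin Tdag)) : Tmin.graph ≤ bGraph Tmin Tdag B := by
  intro p hp
  refine ⟨⟨p, LinearPMap.le_graph_of_le h hp⟩, ?_, rfl⟩
  have hzero : (minSub Tmin Tdag).mkQ ⟨p, LinearPMap.le_graph_of_le h hp⟩ = 0 := by
    rw [Submodule.mkQ_apply, Submodule.Quotient.mk_eq_zero]
    exact hp
  simp only [Submodule.comap_coe, Set.mem_preimage, hzero, SetLike.mem_coe, zero_mem]

theorem graph_TB (Tmin : H₁ →ₗ.[ℂ] H₂) (Tdag : H₂ →ₗ.[ℂ] H₁)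
    (B : Submodule ℂ (HCheck Tmin Tdag)) : (TB Tmin Tdag B).graph = bGraph Tmin Tdag B :=
  Submodule.toLinearPMap_graph_eq _ fun _ hp hp₁ =>
    Tdag.adjoint.graph_fst_eq_zero_snd (bGraph_le_graph Tmin Tdag B hp) hp₁

theorem dense_domain_TB {Tmin : H₁ →ₗ.[ℂ] H₂} {Tdag : H₂ →ₗ.[ℂ] H₁}
    (hd : Dense (Tmin.domain : Set H₁)) (h : Tmin ≤ Tdag.adjoint)
    (B : Submodule ℂ (HCheck Tmin Tdag)) : Dense ((TB Tmin Tdag B).domain : Set H₁) := by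
  have hle : Tmin ≤ TB Tmin Tdag B := LinearPMap.le_of_le_graph <| by
    rw [graph_TB]
    exact graph_le_bGraph h B
  exact hd.mono hle.1

/-- The adjoint relation of the graph of `T_B` is the graph of `T†_{B*}`. -/
theorem adjoint_bGraph {Tmin : H₁ →ₗ.[ℂ] H₂} {Tdag : H₂ →ₗ.[ℂ] H₁}
    (hd : Dense (Tmin.domain : Set H₁)) (h : Tmin ≤ Tdag.adjoint)
    (B : Submodule ℂ (HCheck Tmin Tdag)) :
    (bGraph Tmin Tdag B).adjoint = adjGraph Tmin Tdag B := by
  ext q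
  change _ ↔ q ∈ Tmin.adjoint.graph ∧
    ∀ p ∈ bGraph Tmin Tdag B, ⟪q.2, p.1⟫_ℂ = ⟪q.1, p.2⟫_ℂ
  rw [LinearPMap.adjoint_graph_eq_graph_adjoint hd]
  simp only [Submodule.mem_adjoint_iff, sub_eq_zero]
  constructor
  · intro hq
    refine ⟨fun a b hab => hq a b (graph_le_bGraph h B hab), fun p hp => ?_⟩
    rw [← inner_conj_symm, ← hq p.1 p.2 hp, inner_conj_symm]
  · rintro ⟨-, hq⟩ a b hab
    rw [← inner_conj_symm, ← hq (a, b) hab, inner_conj_symm]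

/-- For a FAP `(T_min, T_min†)` and a generalised boundary condition
`B ⊆ ȟ`, the Hilbert space adjoint of the realisation `T_B` equals the realisation
`T†_{B*}` of `T_min†` determined by the adjoint boundary condition `B*` (the annihilator
of `B` under the boundary pairing `ω(w, v) = ⟪T_max† w, v⟫ − ⟪w, T_max v⟫`). -/
theorem stmt_5 (Tmin : H₁ →ₗ.[ℂ] H₂) (Tdag : H₂ →ₗ.[ℂ] H₁)
    (hd₁ : Dense (Tmin.domain : Set H₁)) (hd₂ : Dense (Tdag.domain : Set H₂))
    (hc₁ : Tmin.IsClosed) (hc₂ : Tdag.IsClosed)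
    (ha₁ : Tmin ≤ Tdag.adjoint) (ha₂ : Tdag ≤ Tmin.adjoint)
    (B : Submodule ℂ (HCheck Tmin Tdag)) :
    (TB Tmin Tdag B).adjoint = (adjGraph Tmin Tdag B).toLinearPMap := by
  rw [← LinearPMap.graph_adjoint_toLinearPMap_eq_adjoint (dense_domain_TB hd₁ ha₁ B), graph_TB,
    adjoint_bGraph hd₁ ha₁]
end
end

section
/- Let S be a closed symmetric densely defined operator on a Hilbert space, identified with the FAP (S, S), and let B ⊆ ȟ := dom(S*)/dom(S) be a closed boundary condition with realisation S_B. Then: (i) S_B is self-adjoint if and only if B is Lagrangian with respect to the boundary pairing ω (i.e. B* = B); (ii) S_B is symmetric if and only if B is isotropic (i.e. B ⊆ B*). -/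
open scoped InnerProductSpace ComplexConjugate
noncomputable section

variable {H₁ H₂ : Type*} [NormedAddCommGroup H₁] [InnerProductSpace ℂ H₁] [CompleteSpace H₁]
  [NormedAddCommGroup H₂] [InnerProductSpace ℂ H₂] [CompleteSpace H₂]

/-- The adjoint boundary condition `B* = {w ∈ ȟ : ω(w, v) = 0 ∀ v ∈ B}` of a boundary
condition `B` for a symmetric operator `S` (identified with the FAP `(S, S)`), where
`ω([q], [p]) = ⟪S* q₁, p₁⟫ − ⟪q₁, S* p₁⟫` is the boundary pairing, expressed via
(arbitrary) lifts to the graph of `S*`. -/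
def omegaAnn {H : Type*} [NormedAddCommGroup H] [InnerProductSpace ℂ H] [CompleteSpace H]
    (S : H →ₗ.[ℂ] H) (B : Submodule ℂ (HCheck S S)) : Set (HCheck S S) :=
  {w | ∀ q : S.adjoint.graph, (Submodule.Quotient.mk q : HCheck S S) = w →
    ∀ p : S.adjoint.graph, (Submodule.Quotient.mk p : HCheck S S) ∈ B →
      ⟪(q : H × H).2, (p : H × H).1⟫_ℂ - ⟪(q : H × H).1, (p : H × H).2⟫_ℂ = 0}

theorem mem_bGraph_iff {Tmin : H₁ →ₗ.[ℂ] H₂} {Tdag : H₂ →ₗ.[ℂ] H₁}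
    {B : Submodule ℂ (HCheck Tmin Tdag)} {q : Tdag.adjoint.graph} :
    (q : H₁ × H₂) ∈ bGraph Tmin Tdag B ↔ (Submodule.Quotient.mk q : HCheck Tmin Tdag) ∈ B := by
  constructor
  · rintro ⟨p, hp, hpq⟩
    obtain rfl : p = q := Subtype.ext hpq
    exact hp
  · exact fun h => ⟨q, h, rfl⟩

theorem bGraph_le {Tmin : H₁ →ₗ.[ℂ] H₂} {Tdag : H₂ →ₗ.[ℂ] H₁}
    (B : Submodule ℂ (HCheck Tmin Tdag)) : bGraph Tmin Tdag B ≤ Tdag.adjoint.graph := by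
  rintro _ ⟨p, -, rfl⟩
  exact p.2

theorem TB_graph {Tmin : H₁ →ₗ.[ℂ] H₂} {Tdag : H₂ →ₗ.[ℂ] H₁}
    (B : Submodule ℂ (HCheck Tmin Tdag)) : (TB Tmin Tdag B).graph = bGraph Tmin Tdag B :=
  Submodule.toLinearPMap_graph_eq _ fun _ hx hx0 =>
    Tdag.adjoint.graph_fst_eq_zero_snd (bGraph_le B hx) hx0

theorem TB_domain_dense {Tmin : H₁ →ₗ.[ℂ] H₂} {Tdag : H₂ →ₗ.[ℂ] H₁} (h : Tmin ≤ Tdag.adjoint)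
    (hd : Dense (Tmin.domain : Set H₁)) (B : Submodule ℂ (HCheck Tmin Tdag)) :
    Dense ((TB Tmin Tdag B).domain : Set H₁) := by
  have hle : Tmin ≤ TB Tmin Tdag B :=
    LinearPMap.le_of_le_graph ((graph_le_bGraph h B).trans (TB_graph B).ge)
  exact hd.mono hle.1

section Symmetric

variable {H : Type*} [NormedAddCommGroup H] [InnerProductSpace ℂ H] [CompleteSpace H]
  {S : H →ₗ.[ℂ] H}

theorem adjoint_bGraph_le (hd : Dense (S.domain : Set H)) (hsymm : S ≤ S.adjoint)
    (B : Submodule ℂ (HCheck S S)) : (bGraph S S B).adjoint ≤ S.adjoint.graph := by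
  intro x hx
  rw [LinearPMap.adjoint_graph_eq_graph_adjoint hd]
  rw [Submodule.mem_adjoint_iff] at hx ⊢
  exact fun a b hab => hx a b (graph_le_bGraph hsymm B hab)

theorem mem_adjoint_iff_inner {g : Submodule ℂ (H × H)} {x : H × H} :
    x ∈ g.adjoint ↔ ∀ p ∈ g, ⟪x.2, p.1⟫_ℂ - ⟪x.1, p.2⟫_ℂ = 0 := by
  rw [Submodule.mem_adjoint_iff, Prod.forall]
  refine forall₃_congr fun a b _ => ?_
  rw [← inner_conj_symm b, ← inner_conj_symm a, ← map_sub, map_eq_zero, sub_eq_zero, sub_eq_zero,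
    eq_comm]

theorem mk_mem_omegaAnn_iff (hd : Dense (S.domain : Set H))
    {B : Submodule ℂ (HCheck S S)} {q : S.adjoint.graph} :
    (Submodule.Quotient.mk q : HCheck S S) ∈ omegaAnn S B ↔
      (q : H × H) ∈ (bGraph S S B).adjoint := by
  rw [mem_adjoint_iff_inner]
  constructor
  · intro h p hp
    exact h q rfl ⟨p, bGraph_le B hp⟩ (mem_bGraph_iff.1 hp)
  · intro h q' hq' p hp
    have hqp := h p (mem_bGraph_iff.2 hp)
    have hmem : (q' : H × H) - q ∈ S.graph := (Submodule.Quotient.eq (minSub S S)).1 hq'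
    have hp' : (p : H × H) ∈ S.graph.adjoint :=
      (LinearPMap.adjoint_graph_eq_graph_adjoint hd).le p.2
    have hdiff := (Submodule.mem_adjoint_iff _ _).1 hp' _ _ hmem
    simp only [inner_sub_left] at hdiff
    linear_combination hdiff + hqp

end Symmetric

/-- Let `S` be a closed symmetric densely defined operator, identified with
the FAP `(S, S)`, and let `B ⊆ ȟ = dom(S*)/dom(S)` be a closed boundary condition with
realisation `S_B`.  Then (i) `S_B` is self-adjoint iff `B` is Lagrangian (`B* = B`), and
(ii) `S_B` is symmetric iff `B` is isotropic (`B ⊆ B*`). -/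
theorem stmt_6 {H : Type*} [NormedAddCommGroup H] [InnerProductSpace ℂ H] [CompleteSpace H]
    (S : H →ₗ.[ℂ] H) (hd : Dense (S.domain : Set H)) (hc : S.IsClosed)
    (hsymm : S ≤ S.adjoint)
    (B : Submodule ℂ (HCheck S S)) (hB : IsClosed (B : Set (HCheck S S))) :
    ((TB S S B).adjoint = TB S S B ↔ omegaAnn S B = (B : Set (HCheck S S))) ∧
    (TB S S B ≤ (TB S S B).adjoint ↔ (B : Set (HCheck S S)) ⊆ omegaAnn S B) := by
  have hTd := TB_domain_dense hsymm hd B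
  have hgraph : (TB S S B).adjoint.graph = (bGraph S S B).adjoint := by
    rw [LinearPMap.adjoint_graph_eq_graph_adjoint hTd, TB_graph]
  constructor
  · have hiff : (TB S S B).adjoint = TB S S B ↔ (bGraph S S B).adjoint = bGraph S S B := by
      rw [← hgraph, ← TB_graph B]
      exact ⟨congrArg _, LinearPMap.eq_of_eq_graph⟩
    rw [hiff]
    constructor
    · intro h
      ext w
      obtain ⟨q, rfl⟩ := Submodule.Quotient.mk_surjective _ w
      rw [mk_mem_omegaAnn_iff hd, h, mem_bGraph_iff, SetLike.mem_coe]
    · intro h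
      have key (q : S.adjoint.graph) :
          (q : H × H) ∈ (bGraph S S B).adjoint ↔ (q : H × H) ∈ bGraph S S B := by
        rw [← mk_mem_omegaAnn_iff hd, h, mem_bGraph_iff, SetLike.mem_coe]
      ext1 x
      exact ⟨fun hx => (key ⟨x, adjoint_bGraph_le hd hsymm B hx⟩).1 hx,
        fun hx => (key ⟨x, bGraph_le B hx⟩).2 hx⟩
  · rw [← LinearPMap.le_graph_iff, hgraph, TB_graph]
    constructor
    · intro h w hw
      obtain ⟨q, rfl⟩ := Submodule.Quotient.mk_surjective _ w
      exact (mk_mem_omegaAnn_iff hd).2 (h (mem_bGraph_iff.2 hw))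
    · rintro h _ ⟨q, hq, rfl⟩
      exact (mk_mem_omegaAnn_iff hd).1 (h hq)
end
end

section
/- Let (T_min, T_min†) be a FAP and B ⊆ ȟ a generalised boundary condition, with Hardy space C := γ(ker T_max). Then ran(T_B) = ran(T_{B + C}), and dom(T_{B+C}) = dom(T_B) + ker(T_max). -/
open scoped InnerProductSpace ComplexConjugate
noncomputable section

variable {H₁ H₂ : Type*} [NormedAddCommGroup H₁] [InnerProductSpace ℂ H₁] [CompleteSpace H₁]
  [NormedAddCommGroup H₂] [InnerProductSpace ℂ H₂] [CompleteSpace H₂]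

/-- Adding the Hardy space to a boundary condition adds the graph of the restriction of `T_max`
to its kernel. -/
theorem bGraph_sup_hardy (Tmin : H₁ →ₗ.[ℂ] H₂) (Tdag : H₂ →ₗ.[ℂ] H₁)
    (B : Submodule ℂ (HCheck Tmin Tdag)) :
    bGraph Tmin Tdag (B ⊔ hardy Tmin Tdag) =
      bGraph Tmin Tdag B ⊔ Tdag.adjoint.graph ⊓ LinearMap.ker (LinearMap.snd ℂ H₁ H₂) := by
  rw [bGraph, hardy, ← Submodule.map_comap_subtype, bGraph, ← Submodule.map_sup]
  congr 1
  conv_lhs => rw [← Submodule.map_comap_eq_of_surjective (minSub Tmin Tdag).mkQ_surjective B]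
  rw [← Submodule.map_sup, Submodule.comap_map_eq, Submodule.ker_mkQ, sup_eq_left]
  refine le_trans ?_ le_sup_left
  exact Submodule.le_comap_mkQ _ B

/-- The domain of the part of a graph over its kernel is the kernel. -/
theorem domOf_inf_ker_snd {E F : Type*} [AddCommGroup E] [AddCommGroup F] [Module ℂ E]
    [Module ℂ F] (G : Submodule ℂ (E × F)) :
    domOf (G ⊓ LinearMap.ker (LinearMap.snd ℂ E F)) = kerOf G := by
  ext x
  simp [domOf, kerOf]

/-- Let `(T_min, T_min†)` be a FAP and `B ⊆ ȟ` a generalised boundary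
condition, with Hardy space `C := γ(ker T_max)`.  Then `ran(T_B) = ran(T_{B + C})` and
`dom(T_{B + C}) = dom(T_B) + ker(T_max)`. -/
theorem stmt_9 (Tmin : H₁ →ₗ.[ℂ] H₂) (Tdag : H₂ →ₗ.[ℂ] H₁)
    (hd₁ : Dense (Tmin.domain : Set H₁)) (hd₂ : Dense (Tdag.domain : Set H₂))
    (hc₁ : Tmin.IsClosed) (hc₂ : Tdag.IsClosed)
    (ha₁ : Tmin ≤ Tdag.adjoint) (ha₂ : Tdag ≤ Tmin.adjoint)
    (B : Submodule ℂ (HCheck Tmin Tdag)) :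
    ranOf (bGraph Tmin Tdag B) = ranOf (bGraph Tmin Tdag (B ⊔ hardy Tmin Tdag)) ∧
    domOf (bGraph Tmin Tdag (B ⊔ hardy Tmin Tdag)) =
      domOf (bGraph Tmin Tdag B) ⊔ kerOf Tdag.adjoint.graph := by
  rw [bGraph_sup_hardy]
  constructor
  · simp only [ranOf, Submodule.map_sup]
    exact (sup_eq_left.2 (Submodule.map_le_iff_le_comap.2 fun p hp => by simp_all)).symm
  · rw [← domOf_inf_ker_snd]
    exact Submodule.map_sup _ _ _
end
end

section
/- Let (T_min, T_min†) be a FAP with closed range (i.e. T_min and T_min† have closed range), and let B ⊆ ȟ be a generalised boundary condition. Then ran(T_B) is closed in H₂ if and only if B + C is a closed subspace of ȟ, where C := γ(ker T_max) is the Hardy space. In particular (taking B = 0) the Hardy space C is a closed subspace of ȟ. -/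
open scoped InnerProductSpace ComplexConjugate
noncomputable section

variable {H₁ H₂ : Type*} [NormedAddCommGroup H₁] [InnerProductSpace ℂ H₁] [CompleteSpace H₁]
  [NormedAddCommGroup H₂] [InnerProductSpace ℂ H₂] [CompleteSpace H₂]

/-- A continuous functional vanishing on the kernel of a surjective continuous linear map
between Banach spaces factors continuously through that map. -/
theorem exists_continuousLinearMap_comp_eq {E F : Type*}
    [NormedAddCommGroup E] [NormedSpace ℂ E] [CompleteSpace E]
    [NormedAddCommGroup F] [NormedSpace ℂ F] [CompleteSpace F]
    (f : E →L[ℂ] F) (hf : Function.Surjective f) (ψ : E →L[ℂ] ℂ)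
    (h : ∀ x, f x = 0 → ψ x = 0) : ∃ φ : F →L[ℂ] ℂ, ∀ x, φ (f x) = ψ x := by
  have hle : LinearMap.ker (f : E →ₗ[ℂ] F) ≤ LinearMap.ker (ψ : E →ₗ[ℂ] ℂ) := fun x hx => h x hx
  let φ : F →ₗ[ℂ] ℂ := (LinearMap.ker (f : E →ₗ[ℂ] F)).liftQ (ψ : E →ₗ[ℂ] ℂ) hle ∘ₗ
    ((f : E →ₗ[ℂ] F).quotKerEquivOfSurjective hf).symm.toLinearMap
  have hφ : ∀ x, φ (f x) = ψ x := fun x => by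
    have hx : ((f : E →ₗ[ℂ] F).quotKerEquivOfSurjective hf).symm (f x) =
        (LinearMap.ker (f : E →ₗ[ℂ] F)).mkQ x := by
      rw [LinearEquiv.symm_apply_eq]
      rfl
    simp only [φ, LinearMap.comp_apply, LinearEquiv.coe_coe, hx]
    rfl
  refine ⟨⟨φ, ?_⟩, hφ⟩
  have hq : Topology.IsQuotientMap f := (f.isOpenMap hf).isQuotientMap f.continuous hf
  refine hq.continuous_iff.2 ?_
  rw [show φ.toFun ∘ f = ψ from funext hφ]
  exact ψ.continuous

/-- For a continuous linear map with closed range between Banach spaces, the image of a subspace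
is closed if and only if the sum of the subspace with the kernel is closed. -/
theorem isClosed_map_iff_isClosed_sup_ker {E F : Type*}
    [NormedAddCommGroup E] [NormedSpace ℂ E] [CompleteSpace E]
    [NormedAddCommGroup F] [NormedSpace ℂ F] [CompleteSpace F]
    (f : E →L[ℂ] F) (hf : IsClosed (Set.range f)) (V : Submodule ℂ E) :
    IsClosed ((V.map (f : E →ₗ[ℂ] F) : Submodule ℂ F) : Set F) ↔
      IsClosed ((V ⊔ LinearMap.ker (f : E →ₗ[ℂ] F) : Submodule ℂ E) : Set E) := by
  rw [← Submodule.comap_map_eq]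
  refine ⟨fun h => h.preimage f.continuous, fun h => ?_⟩
  let R : Submodule ℂ F := LinearMap.range (f : E →ₗ[ℂ] F)
  have hR : IsClosed (R : Set F) := hf
  have : CompleteSpace R := hR.completeSpace_coe
  let g : E →L[ℂ] R := f.codRestrict R fun x => LinearMap.mem_range_self _ x
  have hg : Function.Surjective g := by
    rintro ⟨_, x, rfl⟩
    exact ⟨x, rfl⟩
  have hq : Topology.IsQuotientMap g := (g.isOpenMap hg).isQuotientMap g.continuous hg
  have hcl : IsClosed ((↑) ⁻¹' (V.map (f : E →ₗ[ℂ] F) : Set F) : Set R) :=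
    hq.isClosed_preimage.1 h
  have hle : (V.map (f : E →ₗ[ℂ] F) : Set F) ⊆ R := by
    rintro _ ⟨x, -, rfl⟩
    exact LinearMap.mem_range_self _ x
  have himg : (Subtype.val : R → F) '' (Subtype.val ⁻¹' (V.map (f : E →ₗ[ℂ] F) : Set F)) =
      (V.map (f : E →ₗ[ℂ] F) : Set F) :=
    (Subtype.image_preimage_val (R : Set F) _).trans (Set.inter_eq_right.2 hle)
  exact himg ▸ hR.isClosedEmbedding_subtypeVal.isClosedMap _ hcl

/-- If a closed linear relation between Hilbert spaces has closed range, then the range of its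
adjoint is the orthogonal complement of its kernel. -/
theorem ranOf_adjoint_eq_orthogonal_kerOf {H K : Type*}
    [NormedAddCommGroup H] [InnerProductSpace ℂ H] [CompleteSpace H]
    [NormedAddCommGroup K] [InnerProductSpace ℂ K] [CompleteSpace K]
    (g : Submodule ℂ (H × K)) (hg : IsClosed (g : Set (H × K)))
    (hr : IsClosed (ranOf g : Set K)) : ranOf g.adjoint = (kerOf g)ᗮ := by
  ext y
  rw [Submodule.mem_orthogonal]
  constructor
  · rintro ⟨⟨x, y⟩, hxy, rfl⟩ a ha
    have := (Submodule.mem_adjoint_iff _ _).1 hxy a 0 ha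
    simpa using this
  · intro hy
    have : CompleteSpace g := hg.completeSpace_coe
    have : CompleteSpace (ranOf g) := hr.completeSpace_coe
    let f : g →L[ℂ] ranOf g :=
      ((ContinuousLinearMap.snd ℂ H K).comp g.subtypeL).codRestrict (ranOf g)
        fun z => ⟨z, z.2, rfl⟩
    have hf : Function.Surjective f := by
      rintro ⟨_, z, hz, rfl⟩
      exact ⟨⟨z, hz⟩, rfl⟩
    let ψ : g →L[ℂ] ℂ := (innerSL ℂ y).comp ((ContinuousLinearMap.fst ℂ H K).comp g.subtypeL)
    obtain ⟨φ, hφ⟩ := exists_continuousLinearMap_comp_eq f hf ψ fun z hz => by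
      refine inner_eq_zero_symm.1 (hy z.1.1 ?_)
      have h0 : z.1.2 = 0 := congrArg Subtype.val hz
      change (z.1.1, (0 : K)) ∈ g
      rw [← h0]
      exact z.2
    let x : ranOf g := (InnerProductSpace.toDual ℂ (ranOf g)).symm φ
    refine ⟨((x : K), y), (Submodule.mem_adjoint_iff _ _).2 fun a b hab => ?_, rfl⟩
    have hx : inner ℂ (x : K) b = inner ℂ y a := by
      have h1 : inner ℂ x (f ⟨(a, b), hab⟩) = φ (f ⟨(a, b), hab⟩) :=
        InnerProductSpace.toDual_symm_apply
      exact h1.trans (hφ _)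
    rw [sub_eq_zero, ← inner_conj_symm, hx, inner_conj_symm]

/-- Let `(T_min, T_min†)` be a FAP with closed range (both `T_min` and
`T_min†` have closed range) and let `B ⊆ ȟ` be a generalised boundary condition.  Then
`ran(T_B)` is closed in `H₂` if and only if `B + C` is a closed subspace of `ȟ`, where
`C := γ(ker T_max)` is the Hardy space.  In particular (the case `B = 0`) the Hardy space
`C` is a closed subspace of `ȟ`. -/
theorem stmt_11 (Tmin : H₁ →ₗ.[ℂ] H₂) (Tdag : H₂ →ₗ.[ℂ] H₁)
    (hd₁ : Dense (Tmin.domain : Set H₁)) (hd₂ : Dense (Tdag.domain : Set H₂))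
    (hc₁ : Tmin.IsClosed) (hc₂ : Tdag.IsClosed)
    (ha₁ : Tmin ≤ Tdag.adjoint) (ha₂ : Tdag ≤ Tmin.adjoint)
    (hr₁ : IsClosed ((ranOf Tmin.graph : Submodule ℂ H₂) : Set H₂))
    (hr₂ : IsClosed ((ranOf Tdag.graph : Submodule ℂ H₁) : Set H₁))
    (B : Submodule ℂ (HCheck Tmin Tdag)) :
    (IsClosed ((ranOf (bGraph Tmin Tdag B) : Submodule ℂ H₂) : Set H₂) ↔
      IsClosed ((B ⊔ hardy Tmin Tdag : Submodule ℂ (HCheck Tmin Tdag)) :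
        Set (HCheck Tmin Tdag))) ∧
    IsClosed ((hardy Tmin Tdag : Submodule ℂ (HCheck Tmin Tdag)) : Set (HCheck Tmin Tdag)) := by
  let G := Tdag.adjoint.graph
  let M := minSub Tmin Tdag
  have hG : IsClosed (G : Set (H₁ × H₂)) := LinearPMap.adjoint_isClosed hd₂
  have : CompleteSpace G := hG.completeSpace_coe
  let f : G →L[ℂ] H₂ := (ContinuousLinearMap.snd ℂ H₁ H₂).comp G.subtypeL
  have hf : IsClosed (Set.range f) := by
    have hrange : Set.range f = (ranOf G : Set H₂) := by
      ext y
      constructor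
      · rintro ⟨z, rfl⟩
        exact ⟨z, z.2, rfl⟩
      · rintro ⟨z, hz, rfl⟩
        exact ⟨⟨z, hz⟩, rfl⟩
    rw [hrange, show G = Tdag.graph.adjoint from LinearPMap.adjoint_graph_eq_graph_adjoint hd₂,
      ranOf_adjoint_eq_orthogonal_kerOf _ hc₂ hr₂]
    exact Submodule.isClosed_orthogonal _
  have key : ∀ A : Submodule ℂ (HCheck Tmin Tdag),
      IsClosed ((ranOf (bGraph Tmin Tdag A) : Submodule ℂ H₂) : Set H₂) ↔
        IsClosed ((A ⊔ hardy Tmin Tdag : Submodule ℂ (HCheck Tmin Tdag)) :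
          Set (HCheck Tmin Tdag)) := by
    intro A
    have hran : ranOf (bGraph Tmin Tdag A) = (A.comap M.mkQ).map (f : G →ₗ[ℂ] H₂) :=
      (Submodule.map_comp _ _ _).symm
    have hle : M ≤ A.comap M.mkQ := M.le_comap_mkQ A
    have hsup : (A ⊔ hardy Tmin Tdag).comap M.mkQ =
        A.comap M.mkQ ⊔ LinearMap.ker (f : G →ₗ[ℂ] H₂) := by
      have hmap : A ⊔ hardy Tmin Tdag =
          (A.comap M.mkQ ⊔ LinearMap.ker (f : G →ₗ[ℂ] H₂)).map M.mkQ := by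
        rw [Submodule.map_sup, Submodule.map_comap_eq_of_surjective M.mkQ_surjective]
        rfl
      rw [hmap, Submodule.comap_map_eq_self]
      rw [M.ker_mkQ]
      exact hle.trans le_sup_left
    rw [hran, isClosed_map_iff_isClosed_sup_ker f hf, ← hsup]
    exact M.isQuotientMap_mkQ.isClosed_preimage
      (s := ((A ⊔ hardy Tmin Tdag : Submodule ℂ (HCheck Tmin Tdag)) : Set (HCheck Tmin Tdag)))
  refine ⟨key B, ?_⟩
  have hbot : bGraph Tmin Tdag ⊥ = Tmin.graph := by
    rw [bGraph, Submodule.comap_bot, Submodule.ker_mkQ, minSub, Submodule.map_comap_subtype,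
      inf_eq_right]
    exact LinearPMap.le_graph_of_le ha₁
  have h := key ⊥
  rw [hbot, bot_sup_eq] at h
  exact h.1 hr₁
end
end
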